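/- With the briber's preference order a >_σ b >_σ c, distinguished candidate d = b, and the constructive goal that c not be the unique Veto winner of the final profile (i.e., that a or b be a winner): letting m = min(k, |R|), the briber has a winning strategy from the position (P, R, k) if and only if there exists a set H ⊆ R with |H| = m such that every voter in H has weight at least the weight of every voter in R ∖ H, and for every assignment g : R ∖ H → {a, b}, candidate c is not the unique Veto winner of the final profile in which every voter of H vetoes c and every voter v ∈ R ∖ H vetoes g(v) (each with its own weight). (It is always optimal for the briber to bribe the k heaviest remaining voters to veto c, and the adversary's worst case is to have every nonbribed voter veto a or b.) -/

import Mathlib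

/-- The Veto score of `x` in a profile of weighted Veto ballots (each ballot names
the candidate it vetoes): the sum of the weights of the ballots not vetoing `x`. -/
def vetoScore {C : Type} [DecidableEq C] (P : List (C × ℕ)) (x : C) : ℕ :=
  (P.map (fun e => if e.1 = x then 0 else e.2)).sum

/-- `x` is a Veto winner of profile `P`: its Veto score is maximal. -/
def vetoWinner {C : Type} [DecidableEq C] (P : List (C × ℕ)) (x : C) : Prop :=
  ∀ y : C, vetoScore P y ≤ vetoScore P x

/-- `x` is the unique Veto winner of profile `P`: it is a winner and every winner
equals `x`. -/
def vetoUniqueWinner {C : Type} [DecidableEq C] (P : List (C × ℕ)) (x : C) : Prop :=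
  vetoWinner P x ∧ ∀ y : C, vetoWinner P y → y = x

/-- Online weighted bribery game with bribe limit (pre-reveal position): the briber
can guarantee `goal` from the position in which the profile `P` has already been
cast, the remaining voters have weights listed in `R` (ballots not yet revealed),
and at most `k` bribes may still be used.  At each reveal the briber either keeps
the revealed ballot or, provided a bribe is still available, replaces it by an
arbitrary ballot. -/
def winsLimVeto {C : Type} [DecidableEq C] (goal : List (C × ℕ) → Prop) :
    List (C × ℕ) → List ℕ → ℕ → Prop
  | P, [], _ => goal P
  | P, w :: R, k =>
      ∀ v : C, winsLimVeto goal ((v, w) :: P) R k ∨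
        (1 ≤ k ∧ ∃ v' : C, winsLimVeto goal ((v', w) :: P) R (k - 1))

/-- Total weight of the ballots vetoing `x`. -/
def vw {C : Type} [DecidableEq C] (P : List (C × ℕ)) (x : C) : ℕ :=
  (P.map (fun e => if e.1 = x then e.2 else 0)).sum

theorem vw_cons {C : Type} [DecidableEq C] (P : List (C × ℕ)) (v : C) (w : ℕ) (x : C) :
    vw ((v, w) :: P) x = (if v = x then w else 0) + vw P x := by
  simp [vw]

theorem score_add_vw {C : Type} [DecidableEq C] (P : List (C × ℕ)) (x : C) :
    vetoScore P x + vw P x = (P.map Prod.snd).sum := by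
  induction P with
  | nil => simp [vetoScore, vw]
  | cons e P ih =>
    simp only [vetoScore, vw, List.map_cons, List.sum_cons] at *
    split_ifs <;> omega

theorem unique_iff {C : Type} [DecidableEq C] (a b c : C)
    (hac : a ≠ c) (hbc : b ≠ c)
    (hall : ∀ x : C, x = a ∨ x = b ∨ x = c) (P : List (C × ℕ)) :
    vetoUniqueWinner P c ↔ vw P c < vw P a ∧ vw P c < vw P b := by
  have ha := score_add_vw P a
  have hb := score_add_vw P b
  have hc := score_add_vw P c
  constructor
  · rintro ⟨h1, h2⟩
    have h1a := h1 a
    have h1b := h1 b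
    have key : ∀ y, y ≠ c → vetoScore P y ≠ vetoScore P c := by
      intro y hy he
      exact hy (h2 y (fun z => by rw [he]; exact h1 z))
    have := key a hac
    have := key b hbc
    omega
  · rintro ⟨h1, h2⟩
    refine ⟨fun y => ?_, fun y hy => ?_⟩
    · rcases hall y with rfl | rfl | rfl <;> omega
    · have := hy c
      rcases hall y with rfl | rfl | rfl
      · omega
      · omega
      · rfl

theorem briber_wins {C : Type} [DecidableEq C] (a b c : C)
    (hab : a ≠ b) (hac : a ≠ c) (hbc : b ≠ c)
    (hall : ∀ x : C, x = a ∨ x = b ∨ x = c) (R : List ℕ) :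
    ∀ (P : List (C × ℕ)) (k : ℕ) (hs rest : Multiset ℕ),
      (R : Multiset ℕ) = hs + rest → hs.card ≤ k →
      (∀ xs ys : Multiset ℕ, xs + ys = rest →
        ¬ (vw P c + hs.sum < vw P a + xs.sum ∧ vw P c + hs.sum < vw P b + ys.sum)) →
      winsLimVeto (fun F => ¬ vetoUniqueWinner F c) P R k := by
  induction R with
  | nil =>
    intro P k hs rest hR hk h
    have h0 : hs + rest = 0 := by rw [← hR]; rfl
    obtain ⟨rfl, rfl⟩ := add_eq_zero.mp h0
    have := h 0 0 rfl
    simp only [winsLimVeto, unique_iff a b c hac hbc hall]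
    simpa using this
  | cons w R ih =>
    intro P k hs rest hR hk h v
    rw [← Multiset.cons_coe] at hR
    have hw : w ∈ hs + rest := by rw [← hR]; simp
    rcases Multiset.mem_add.mp hw with hw | hw
    · obtain ⟨hs, rfl⟩ := Multiset.exists_cons_of_mem hw
      rw [Multiset.cons_add, Multiset.cons_inj_right] at hR
      rw [Multiset.card_cons] at hk
      refine Or.inr ⟨by omega, c, ih _ _ hs rest hR (by omega) ?_⟩
      intro xs ys hxy
      have := h xs ys hxy
      simp only [vw_cons, hac.symm, hbc.symm, if_true, if_false, Multiset.sum_cons] at *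
      omega
    · obtain ⟨rest, rfl⟩ := Multiset.exists_cons_of_mem hw
      rw [Multiset.add_cons, Multiset.cons_inj_right] at hR
      refine Or.inl (ih _ _ hs rest hR hk ?_)
      intro xs ys hxy
      have h1 := h (w ::ₘ xs) ys (by rw [Multiset.cons_add, hxy])
      have h2 := h xs (w ::ₘ ys) (by rw [Multiset.add_cons, hxy])
      rcases hall v with rfl | rfl | rfl <;>
      simp only [vw_cons, hab, hac, hbc, hab.symm, hac.symm, hbc.symm, if_true, if_false,
        Multiset.sum_cons] at * <;> omega

theorem exists_max_mem (s : Multiset ℕ) (h : s ≠ 0) : ∃ u ∈ s, ∀ x ∈ s, x ≤ u := by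
  have hn : s.toFinset.Nonempty := by
    obtain ⟨x, hx⟩ := Multiset.exists_mem_of_ne_zero h
    exact ⟨x, by simpa using hx⟩
  obtain ⟨u, hu, hm⟩ := s.toFinset.exists_max_image id hn
  exact ⟨u, by simpa using hu, fun x hx => hm x (by simpa using hx)⟩

theorem exists_min_mem (s : Multiset ℕ) (h : s ≠ 0) : ∃ u ∈ s, ∀ x ∈ s, u ≤ x := by
  have hn : s.toFinset.Nonempty := by
    obtain ⟨x, hx⟩ := Multiset.exists_mem_of_ne_zero h
    exact ⟨x, by simpa using hx⟩
  obtain ⟨u, hu, hm⟩ := s.toFinset.exists_min_image id hn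
  exact ⟨u, by simpa using hu, fun x hx => hm x (by simpa using hx)⟩

theorem adversary_wins {C : Type} [DecidableEq C] (a b c : C)
    (hab : a ≠ b) (hac : a ≠ c) (hbc : b ≠ c)
    (hall : ∀ x : C, x = a ∨ x = b ∨ x = c) (R : List ℕ) :
    ∀ (P : List (C × ℕ)) (k : ℕ) (hs xs ys : Multiset ℕ),
      (R : Multiset ℕ) = hs + (xs + ys) →
      (k ≤ hs.card ∨ xs + ys = 0) →
      (∀ h ∈ hs, ∀ u ∈ xs + ys, u ≤ h) →
      vw P c + hs.sum < vw P a + xs.sum → vw P c + hs.sum < vw P b + ys.sum →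
      ¬ winsLimVeto (fun F => ¬ vetoUniqueWinner F c) P R k := by
  induction R with
  | nil =>
    intro P k hs xs ys hR hk ht h1 h2
    have h0 : hs + (xs + ys) = 0 := by rw [← hR]; rfl
    obtain ⟨rfl, h3⟩ := add_eq_zero.mp h0
    obtain ⟨rfl, rfl⟩ := add_eq_zero.mp h3
    simp only [winsLimVeto, unique_iff a b c hac hbc hall, not_not]
    simpa using And.intro h1 h2
  | cons w R ih =>
    intro P k hs xs ys hR hk ht h1 h2 hwin
    rw [← Multiset.cons_coe] at hR
    have hw : w ∈ hs + (xs + ys) := by rw [← hR]; simp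
    rcases Multiset.mem_add.mp hw with hw | hw
    · obtain ⟨hs, rfl⟩ := Multiset.exists_cons_of_mem hw
      rw [Multiset.cons_add, Multiset.cons_inj_right] at hR
      rw [Multiset.card_cons] at hk
      rw [Multiset.sum_cons] at h1 h2
      -- bribing this voter never helps
      have hbr : ∀ v', ¬ winsLimVeto (fun F => ¬ vetoUniqueWinner F c) ((v', w) :: P) R (k - 1) := by
        intro v'
        refine ih _ _ hs xs ys hR (hk.imp_left (by omega)) (fun h hh => ht h (by simp [hh])) ?_ ?_ <;>
        · rcases hall v' with rfl | rfl | rfl <;>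
          simp only [vw_cons, hab, hac, hbc, hab.symm, hac.symm, hbc.symm, if_true, if_false] <;>
          omega
      by_cases h0 : xs + ys = 0
      · rcases hwin a with hk' | ⟨_, v', hv'⟩
        · refine ih _ _ hs xs ys hR (Or.inr h0) (fun h hh => ht h (by simp [hh])) ?_ ?_ hk' <;>
          · simp only [vw_cons, hab, hac, if_true, if_false]
            omega
        · exact hbr v' hv'
      · obtain ⟨u, hu, hmax⟩ := exists_max_mem _ h0
        have huw : u ≤ w := ht w (by simp) u hu
        have hk1 : k ≤ hs.card + 1 := by tauto
        rcases Multiset.mem_add.mp hu with hu | hu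
        · obtain ⟨xs, rfl⟩ := Multiset.exists_cons_of_mem hu
          rw [Multiset.sum_cons] at h1
          rcases hwin a with hk' | ⟨_, v', hv'⟩
          · refine ih _ _ (u ::ₘ hs) xs ys ?_ ?_ ?_ ?_ ?_ hk'
            · rw [hR]; simp
            · left; simpa using hk1
            · intro h hh x hx
              have hx' : x ∈ (u ::ₘ xs) + ys := by
                rw [Multiset.cons_add]; exact Multiset.mem_cons_of_mem hx
              rcases Multiset.mem_cons.mp hh with rfl | hh
              · exact hmax x hx'
              · exact ht h (by simp [hh]) x hx'
            all_goals
              simp only [vw_cons, hab, hac, if_true, if_false, Multiset.sum_cons]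
              omega
          · exact hbr v' hv'
        · obtain ⟨ys, rfl⟩ := Multiset.exists_cons_of_mem hu
          rw [Multiset.sum_cons] at h2
          rcases hwin b with hk' | ⟨_, v', hv'⟩
          · refine ih _ _ (u ::ₘ hs) xs ys ?_ ?_ ?_ ?_ ?_ hk'
            · rw [hR]; simp
            · left; simpa using hk1
            · intro h hh x hx
              have hx' : x ∈ xs + (u ::ₘ ys) := by
                rw [Multiset.add_cons]; exact Multiset.mem_cons_of_mem hx
              rcases Multiset.mem_cons.mp hh with rfl | hh
              · exact hmax x hx'
              · exact ht h (by simp [hh]) x hx'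
            all_goals
              simp only [vw_cons, hab.symm, hbc, if_true, if_false, Multiset.sum_cons]
              omega
          · exact hbr v' hv'
    · have hne : xs + ys ≠ 0 := by
        intro h0; rw [h0] at hw; simp at hw
      have hk1 : k ≤ hs.card := by tauto
      rcases Multiset.mem_add.mp hw with hw' | hw'
      · obtain ⟨xs, rfl⟩ := Multiset.exists_cons_of_mem hw'
        rw [Multiset.cons_add, Multiset.add_cons, Multiset.cons_inj_right] at hR
        rw [Multiset.sum_cons] at h1
        have hsub : ∀ x ∈ xs + ys, x ∈ (w ::ₘ xs) + ys := fun x hx => by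
          rw [Multiset.cons_add]; exact Multiset.mem_cons_of_mem hx
        rcases hwin a with hk' | ⟨hk2, v', hv'⟩
        · refine ih _ _ hs xs ys hR (Or.inl hk1) (fun h hh x hx => ht h hh x (hsub x hx))
            ?_ ?_ hk' <;>
          · simp only [vw_cons, hab, hac, if_true, if_false]
            omega
        · obtain ⟨h, hh, hmin⟩ := exists_min_mem hs (by rintro rfl; simp at hk1; omega)
          obtain ⟨hs, rfl⟩ := Multiset.exists_cons_of_mem hh
          have hwh : w ≤ h := ht h hh w (by simp)
          rw [Multiset.sum_cons] at h1 h2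
          rw [Multiset.card_cons] at hk1
          refine ih _ _ hs (h ::ₘ xs) ys ?_ (Or.inl (by omega)) ?_ ?_ ?_ hv'
          · rw [hR]; simp
          · intro z hz x hx
            have hz' : z ∈ h ::ₘ hs := Multiset.mem_cons_of_mem hz
            rw [Multiset.cons_add] at hx
            rcases Multiset.mem_cons.mp hx with rfl | hx
            · exact hmin z hz'
            · exact ht z hz' x (hsub x hx)
          all_goals
            rcases hall v' with rfl | rfl | rfl <;>
            simp only [vw_cons, hab, hac, hbc, hab.symm, hac.symm, hbc.symm, if_true, if_false,
              Multiset.sum_cons] <;>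
            omega
      · obtain ⟨ys, rfl⟩ := Multiset.exists_cons_of_mem hw'
        rw [Multiset.add_cons, Multiset.add_cons, Multiset.cons_inj_right] at hR
        rw [Multiset.sum_cons] at h2
        have hsub : ∀ x ∈ xs + ys, x ∈ xs + (w ::ₘ ys) := fun x hx => by
          rw [Multiset.add_cons]; exact Multiset.mem_cons_of_mem hx
        rcases hwin b with hk' | ⟨hk2, v', hv'⟩
        · refine ih _ _ hs xs ys hR (Or.inl hk1) (fun h hh x hx => ht h hh x (hsub x hx))
            ?_ ?_ hk' <;>
          · simp only [vw_cons, hab.symm, hbc, if_true, if_false]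
            omega
        · obtain ⟨h, hh, hmin⟩ := exists_min_mem hs (by rintro rfl; simp at hk1; omega)
          obtain ⟨hs, rfl⟩ := Multiset.exists_cons_of_mem hh
          have hwh : w ≤ h := ht h hh w (by simp)
          rw [Multiset.sum_cons] at h1 h2
          rw [Multiset.card_cons] at hk1
          refine ih _ _ hs xs (h ::ₘ ys) ?_ (Or.inl (by omega)) ?_ ?_ ?_ hv'
          · rw [hR]; simp
          · intro z hz x hx
            have hz' : z ∈ h ::ₘ hs := Multiset.mem_cons_of_mem hz
            rw [Multiset.add_cons] at hx
            rcases Multiset.mem_cons.mp hx with rfl | hx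
            · exact hmin z hz'
            · exact ht z hz' x (hsub x hx)
          all_goals
            rcases hall v' with rfl | rfl | rfl <;>
            simp only [vw_cons, hab, hac, hbc, hab.symm, hac.symm, hbc.symm, if_true, if_false,
              Multiset.sum_cons] <;>
            omega

theorem exists_top {n : ℕ} (f : Fin n → ℕ) (m : ℕ) (hm : m ≤ n) :
    ∃ H : Finset (Fin n), H.card = m ∧ ∀ i ∈ H, ∀ j, j ∉ H → f j ≤ f i := by
  induction m with
  | zero => exact ⟨∅, by simp⟩
  | succ m ih =>
    obtain ⟨H, hc, hH⟩ := ih (by omega)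
    have hne : (Hᶜ).Nonempty := by
      rw [← Finset.card_pos, Finset.card_compl, Fintype.card_fin]; omega
    obtain ⟨u, hu, hmax⟩ := (Hᶜ).exists_max_image f hne
    rw [Finset.mem_compl] at hu
    refine ⟨insert u H, by rw [Finset.card_insert_of_notMem hu, hc], ?_⟩
    intro i hi j hj
    rw [Finset.mem_insert, not_or] at hj
    rcases Finset.mem_insert.mp hi with rfl | hi
    · exact hmax j (by simpa using hj.2)
    · exact hH i hi j hj.2

/-- Splitting the image of a finset as a sum of multisets comes from a splitting of the finset. -/
theorem exists_split {ι : Type} [DecidableEq ι] (f : ι → ℕ) (s : Finset ι) :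
    ∀ xs ys : Multiset ℕ, xs + ys = s.val.map f →
      ∃ t ⊆ s, ∑ i ∈ t, f i = xs.sum ∧ ∑ i ∈ s \ t, f i = ys.sum := by
  induction s using Finset.induction_on with
  | empty =>
    intro xs ys h
    obtain ⟨rfl, rfl⟩ := add_eq_zero.mp (h.trans (by simp))
    exact ⟨∅, by simp⟩
  | insert i s hi ih =>
    intro xs ys h
    rw [Finset.insert_val_of_notMem hi, Multiset.map_cons] at h
    have hm : f i ∈ xs + ys := by rw [h]; simp
    rcases Multiset.mem_add.mp hm with hm | hm
    · obtain ⟨xs, e⟩ := Multiset.exists_cons_of_mem hm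
      subst e
      rw [Multiset.cons_add, Multiset.cons_inj_right] at h
      obtain ⟨t, hts, h1, h2⟩ := ih xs ys h
      have hit : i ∉ t := fun h => hi (hts h)
      refine ⟨insert i t, Finset.insert_subset_insert i hts, ?_, ?_⟩
      · rw [Finset.sum_insert hit, h1, Multiset.sum_cons]
      · rw [← h2]; congr 1
        ext j; simp only [Finset.mem_sdiff, Finset.mem_insert]; grind
    · obtain ⟨ys, e⟩ := Multiset.exists_cons_of_mem hm
      subst e
      rw [Multiset.add_cons, Multiset.cons_inj_right] at h
      obtain ⟨t, hts, h1, h2⟩ := ih xs ys h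
      have hit : i ∉ t := fun h => hi (hts h)
      refine ⟨t, hts.trans (Finset.subset_insert i s), h1, ?_⟩
      rw [Finset.insert_sdiff_of_notMem _ hit, Finset.sum_insert (by simp [hi]), h2,
        Multiset.sum_cons]

theorem vw_final {C : Type} [DecidableEq C] (P : List (C × ℕ)) {n : ℕ} (F : Fin n → C)
    (f : Fin n → ℕ) (x : C) :
    vw (P ++ List.ofFn (fun i => (F i, f i))) x
      = vw P x + ∑ i ∈ Finset.univ.filter (fun i => F i = x), f i := by
  simp only [vw, List.map_append, List.sum_append, List.map_ofFn, List.sum_ofFn,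
    Finset.sum_filter]
  rfl

theorem coe_eq_map (R : List ℕ) :
    (R : Multiset ℕ) = (Finset.univ : Finset (Fin R.length)).val.map R.get := by
  have : R = List.ofFn R.get := (List.ofFn_get R).symm
  conv_lhs => rw [this]
  rw [Fin.univ_val_map]

theorem map_split {n : ℕ} (f : Fin n → ℕ) (s t : Finset (Fin n)) (h : t ⊆ s) :
    s.val.map f = t.val.map f + (s \ t).val.map f := by
  rw [← Multiset.map_add, Finset.sdiff_val, add_tsub_cancel_of_le (Finset.val_le_iff.mpr h)]

/-- 3-candidate Veto, briber's preference `a >_σ b >_σ c`, distinguished candidate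
`d = b`, constructive goal: `c` is not the unique Veto winner of the final profile.
It is optimal for the briber to bribe the `min k |R|` heaviest remaining voters to
veto `c`, and the adversary's worst case is to have every nonbribed voter veto
`a` or `b`. -/
theorem veto3_online_weighted_limited_constructive_b
    {C : Type} [DecidableEq C] (a b c : C)
    (hab : a ≠ b) (hac : a ≠ c) (hbc : b ≠ c)
    (hall : ∀ x : C, x = a ∨ x = b ∨ x = c)
    (P : List (C × ℕ)) (R : List ℕ) (k : ℕ) :
    winsLimVeto (fun F => ¬ vetoUniqueWinner F c) P R k ↔
      ∃ H : Finset (Fin R.length),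
        H.card = min k R.length ∧
        (∀ i ∈ H, ∀ j : Fin R.length, j ∉ H → R.get j ≤ R.get i) ∧
        ∀ g : Fin R.length → C, (∀ i : Fin R.length, i ∉ H → g i = a ∨ g i = b) →
          ¬ vetoUniqueWinner
              (P ++ List.ofFn (fun i => (if i ∈ H then c else g i, R.get i))) c := by
  constructor
  · intro hwin
    obtain ⟨H, hc, htop⟩ := exists_top R.get (min k R.length) (min_le_right _ _)
    refine ⟨H, hc, htop, fun g hg hu => ?_⟩
    rw [unique_iff a b c hac hbc hall, vw_final, vw_final, vw_final] at hu
    set X := Hᶜ.filter (fun i => g i = a) with hX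
    have hXs : X ⊆ Hᶜ := Finset.filter_subset _ _
    have ec : Finset.univ.filter (fun i => (if i ∈ H then c else g i) = c) = H := by
      ext i; simp only [Finset.mem_filter, Finset.mem_univ, true_and]; grind
    have ea : Finset.univ.filter (fun i => (if i ∈ H then c else g i) = a) = X := by
      ext i; simp only [hX, Finset.mem_filter, Finset.mem_univ, true_and, Finset.mem_compl]; grind
    have eb : Finset.univ.filter (fun i => (if i ∈ H then c else g i) = b) = Hᶜ \ X := by
      ext i
      simp only [hX, Finset.mem_filter, Finset.mem_univ, true_and, Finset.mem_compl,
        Finset.mem_sdiff]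
      grind
    rw [ec, ea, eb] at hu
    have hsplit := map_split R.get Hᶜ X hXs
    refine adversary_wins a b c hab hac hbc hall R P k (H.val.map R.get) (X.val.map R.get)
      ((Hᶜ \ X).val.map R.get) ?_ ?_ ?_ hu.1 hu.2 hwin
    · rw [← hsplit, coe_eq_map, map_split R.get Finset.univ H (Finset.subset_univ _),
        Finset.compl_eq_univ_sdiff]
    · rw [← hsplit, Multiset.card_map, Finset.card_val, hc]
      rcases le_total k R.length with h | h
      · left; omega
      · right
        have : H = Finset.univ := by
          rw [← Finset.card_eq_iff_eq_univ, hc, Fintype.card_fin]; omega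
        simp [this]
    · rw [← hsplit]
      intro h hh u hu
      obtain ⟨i, hi, rfl⟩ := Multiset.mem_map.mp hh
      obtain ⟨j, hj, rfl⟩ := Multiset.mem_map.mp hu
      exact htop i hi j (Finset.mem_compl.mp hj)
  · rintro ⟨H, hc, -, hgood⟩
    refine briber_wins a b c hab hac hbc hall R P k (H.val.map R.get) (Hᶜ.val.map R.get) ?_ ?_ ?_
    · rw [coe_eq_map, map_split R.get Finset.univ H (Finset.subset_univ _),
        Finset.compl_eq_univ_sdiff]
    · rw [Multiset.card_map, Finset.card_val, hc]; omega
    · intro xs ys hxy hlt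
      obtain ⟨t, hts, h1, h2⟩ := exists_split R.get Hᶜ xs ys hxy
      have hts' : ∀ i ∈ t, i ∉ H := fun i hi => Finset.mem_compl.mp (hts hi)
      refine hgood (fun i => if i ∈ t then a else b) (fun i _ => by grind) ?_
      rw [unique_iff a b c hac hbc hall, vw_final, vw_final, vw_final]
      have ec : Finset.univ.filter
          (fun i => (if i ∈ H then c else if i ∈ t then a else b) = c) = H := by
        ext i; simp only [Finset.mem_filter, Finset.mem_univ, true_and]; grind
      have ea : Finset.univ.filter
          (fun i => (if i ∈ H then c else if i ∈ t then a else b) = a) = t := by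
        ext i; simp only [Finset.mem_filter, Finset.mem_univ, true_and]; grind
      have eb : Finset.univ.filter
          (fun i => (if i ∈ H then c else if i ∈ t then a else b) = b) = Hᶜ \ t := by
        ext i
        simp only [Finset.mem_filter, Finset.mem_univ, true_and, Finset.mem_compl,
          Finset.mem_sdiff]
        grind
      rw [ec, ea, eb, h1, h2]
      exact hlt
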